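/- Let φ = C_1 ∧ … ∧ C_m (m ≥ 1) be a CNF formula over a variable set V with |V| = n, such that every clause is non-empty and contains no complementary pair of literals, let F_φ be its standard translation, and let k = 2n + m + 1. Then: (1) φ is satisfiable if and only if F_φ has exactly k stable-facets, and (2) φ is unsatisfiable if and only if F_φ has exactly k−1 stable-facets. -/

import Mathlib

def conflictFree {α : Type*} (A : Set α) (R : Set (α × α)) (E : Set α) : Prop :=
  E ⊆ A ∧ ∀ x ∈ E, ∀ y ∈ E, (x, y) ∉ R

def defended {α : Type*} (R : Set (α × α)) (E : Set α) (x : α) : Prop :=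
  ∀ y, (y, x) ∈ R → ∃ z ∈ E, (z, y) ∈ R

def admissible {α : Type*} (A : Set α) (R : Set (α × α)) (E : Set α) : Prop :=
  conflictFree A R E ∧ ∀ x ∈ E, defended R E x

def stable {α : Type*} (A : Set α) (R : Set (α × α)) (E : Set α) : Prop :=
  conflictFree A R E ∧ ∀ x ∈ A, x ∉ E → ∃ y ∈ E, (y, x) ∈ R

def naive {α : Type*} (A : Set α) (R : Set (α × α)) (E : Set α) : Prop :=
  conflictFree A R E ∧ ∀ E', E ⊂ E' → ¬ conflictFree A R E'

def preferred {α : Type*} (A : Set α) (R : Set (α × α)) (E : Set α) : Prop :=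
  admissible A R E ∧ ∀ E', E ⊂ E' → ¬ admissible A R E'

def complete {α : Type*} (A : Set α) (R : Set (α × α)) (E : Set α) : Prop :=
  admissible A R E ∧ ∀ x ∈ A, defended R E x → x ∈ E

def credAccepted {α : Type*} (σ : Set α → Prop) (x : α) : Prop :=
  ∃ E, σ E ∧ x ∈ E

def isFacet {α : Type*} (σ : Set α → Prop) (x : α) : Prop :=
  (∃ E, σ E ∧ x ∈ E) ∧ ¬ ∀ E, σ E → x ∈ E

/-- A literal over variables `V`: a variable or its negation. -/
inductive Lit (V : Type*) where
  | pos (x : V)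
  | neg (x : V)
deriving DecidableEq

/-- The complement of a literal. -/
def Lit.compl {V : Type*} : Lit V → Lit V
  | .pos x => .neg x
  | .neg x => .pos x

/-- Evaluation of a literal under a truth assignment. -/
def Lit.eval {V : Type*} (θ : V → Bool) : Lit V → Bool
  | .pos x => θ x
  | .neg x => !θ x

/-- An assignment satisfies a clause (a finite set of literals). -/
def satClause {V : Type*} (θ : V → Bool) (c : Finset (Lit V)) : Prop :=
  ∃ ℓ ∈ c, Lit.eval θ ℓ = true

/-- An assignment satisfies a CNF with clauses `C 0, …, C (m-1)`. -/
def satCNF {V : Type*} {m : ℕ} (θ : V → Bool) (C : Fin m → Finset (Lit V)) : Prop :=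
  ∀ i, satClause θ (C i)

/-- The arguments of the standard translation `F_φ`: the formula argument,
one argument per clause, and one argument per literal. -/
inductive Arg (V : Type*) (m : ℕ) where
  | fm
  | clause (i : Fin m)
  | lit (ℓ : Lit V)

/-- The attack relation of the standard translation `F_φ`. -/
def attacksOf {V : Type*} {m : ℕ} (C : Fin m → Finset (Lit V)) :
    Set (Arg V m × Arg V m) :=
  {p | (∃ i : Fin m, p = (Arg.clause i, Arg.fm)) ∨
       (∃ ℓ : Lit V, p = (Arg.lit ℓ, Arg.lit ℓ.compl)) ∨
       (∃ i : Fin m, ∃ ℓ ∈ C i, p = (Arg.lit ℓ, Arg.clause i))}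

/-- The set of literal arguments made true by the assignment `θ`. -/
def thetaArgs {V : Type*} (m : ℕ) (θ : V → Bool) : Set (Arg V m) :=
  {x | ∃ ℓ : Lit V, Lit.eval θ ℓ = true ∧ x = Arg.lit ℓ}

def extOf {V : Type*} {m : ℕ} (C : Fin m → Finset (Lit V)) (θ : V → Bool) : Set (Arg V m) :=
  {x | match x with
    | .fm => satCNF θ C
    | .clause i => ¬ satClause θ (C i)
    | .lit ℓ => Lit.eval θ ℓ = true}

theorem att_fm {V : Type*} {m : ℕ} (C : Fin m → Finset (Lit V)) (y : Arg V m) :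
    (y, Arg.fm) ∈ attacksOf C ↔ ∃ i, y = .clause i := by
  simp [attacksOf]

theorem att_clause {V : Type*} {m : ℕ} (C : Fin m → Finset (Lit V)) (y : Arg V m) (i : Fin m) :
    (y, Arg.clause i) ∈ attacksOf C ↔ ∃ ℓ ∈ C i, y = .lit ℓ := by
  simp only [attacksOf, Set.mem_ofPred_eq, Prod.mk.injEq, reduceCtorEq, and_false, exists_false,
    false_or, Arg.clause.injEq]
  constructor
  · rintro ⟨j, ℓ, h, rfl, rfl⟩
    exact ⟨ℓ, h, rfl⟩
  · rintro ⟨ℓ, h, rfl⟩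
    exact ⟨i, ℓ, h, rfl, rfl⟩

theorem compl_compl' {V : Type*} (ℓ : Lit V) : ℓ.compl.compl = ℓ := by cases ℓ <;> rfl

theorem eval_compl {V : Type*} (θ : V → Bool) (ℓ : Lit V) : ℓ.compl.eval θ = !(ℓ.eval θ) := by
  cases ℓ <;> simp [Lit.compl, Lit.eval]

theorem att_lit {V : Type*} {m : ℕ} (C : Fin m → Finset (Lit V)) (y : Arg V m) (ℓ : Lit V) :
    (y, Arg.lit ℓ) ∈ attacksOf C ↔ y = .lit ℓ.compl := by
  simp only [attacksOf, Set.mem_ofPred_eq, Prod.mk.injEq, reduceCtorEq, and_false, exists_false,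
    false_or, or_false, Arg.lit.injEq]
  constructor
  · rintro ⟨l, rfl, rfl⟩
    rw [compl_compl']
  · rintro rfl
    exact ⟨ℓ.compl, rfl, (compl_compl' ℓ).symm⟩

theorem stable_extOf {V : Type*} {m : ℕ} (C : Fin m → Finset (Lit V)) (θ : V → Bool) :
    stable Set.univ (attacksOf C) (extOf C θ) := by
  refine ⟨⟨Set.subset_univ _, ?_⟩, ?_⟩
  · intro x hx y hy h
    cases y with
    | fm =>
      obtain ⟨i, rfl⟩ := (att_fm C x).1 h
      exact hx (hy i)
    | clause i =>
      obtain ⟨ℓ, hl, rfl⟩ := (att_clause C x i).1 h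
      exact hy ⟨ℓ, hl, hx⟩
    | lit ℓ =>
      obtain rfl := (att_lit C x ℓ).1 h
      have h1 : ℓ.compl.eval θ = true := hx
      have h2 : ℓ.eval θ = true := hy
      rw [eval_compl, h2] at h1
      cases h1
  · intro x _ hx
    cases x with
    | fm =>
      have h : ¬ satCNF θ C := hx
      simp only [satCNF, not_forall] at h
      obtain ⟨i, hi⟩ := h
      exact ⟨.clause i, hi, (att_fm C _).2 ⟨i, rfl⟩⟩
    | clause i =>
      have h : ¬ ¬ satClause θ (C i) := hx
      obtain ⟨ℓ, hl, he⟩ := not_not.1 h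
      exact ⟨.lit ℓ, he, (att_clause C _ i).2 ⟨ℓ, hl, rfl⟩⟩
    | lit ℓ =>
      have h : ¬ ℓ.eval θ = true := hx
      refine ⟨.lit ℓ.compl, ?_, (att_lit C _ ℓ).2 rfl⟩
      show ℓ.compl.eval θ = true
      rw [eval_compl]; simpa using h

theorem sat_of_fm {V : Type*} {m : ℕ} (C : Fin m → Finset (Lit V)) (E : Set (Arg V m))
    (hE : stable Set.univ (attacksOf C) E) (hf : Arg.fm ∈ E) : ∃ θ, satCNF θ C := by
  classical
  refine ⟨fun x => decide (Arg.lit (.pos x) ∈ E), fun i => ?_⟩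
  have hi : Arg.clause i ∉ E := fun h => hE.1.2 _ h _ hf ((att_fm C _).2 ⟨i, rfl⟩)
  obtain ⟨y, hy, ha⟩ := hE.2 _ (Set.mem_univ _) hi
  obtain ⟨ℓ, hl, rfl⟩ := (att_clause C y i).1 ha
  refine ⟨ℓ, hl, ?_⟩
  cases ℓ with
  | pos x => simpa [Lit.eval] using hy
  | neg x =>
    have : Arg.lit (.pos x) ∉ E := fun h => hE.1.2 _ h _ hy ((att_lit C _ _).2 rfl)
    simpa [Lit.eval] using this

theorem exists_eval {V : Type*} (ℓ : Lit V) : ∃ θ : V → Bool, ℓ.eval θ = true := by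
  cases ℓ with
  | pos x => exact ⟨fun _ => true, rfl⟩
  | neg x => exact ⟨fun _ => false, rfl⟩

theorem exists_falsify {V : Type*} (c : Finset (Lit V)) (h : ∀ ℓ ∈ c, ℓ.compl ∉ c) :
    ∃ θ : V → Bool, ¬ satClause θ c := by
  classical
  refine ⟨fun x => decide (Lit.neg x ∈ c), ?_⟩
  rintro ⟨ℓ, hl, he⟩
  cases ℓ with
  | pos x => exact h _ hl (by simpa [Lit.eval, Lit.compl] using he)
  | neg x => simp [Lit.eval] at he; exact he hl

def argEquiv (V : Type*) (m : ℕ) : Arg V m ≃ Option (Fin m ⊕ (V ⊕ V)) where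
  toFun
    | .fm => none
    | .clause i => some (.inl i)
    | .lit (.pos x) => some (.inr (.inl x))
    | .lit (.neg x) => some (.inr (.inr x))
  invFun
    | none => .fm
    | some (.inl i) => .clause i
    | some (.inr (.inl x)) => .lit (.pos x)
    | some (.inr (.inr x)) => .lit (.neg x)
  left_inv x := by rcases x with _ | _ | (_ | _) <;> rfl
  right_inv x := by rcases x with _ | (_ | (_ | _)) <;> rfl

/-- With `k = 2n + m + 1` (for `n` variables, `m ≥ 1` clauses, all clauses
non-empty and without complementary pairs): `φ` is satisfiable iff `F_φ` has
exactly `k` stable-facets, and `φ` is unsatisfiable iff `F_φ` has exactly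
`k - 1` stable-facets. -/
theorem facet_count_characterizes_satisfiability {V : Type*} [Fintype V] [DecidableEq V]
    {m : ℕ} (hm : 1 ≤ m) (C : Fin m → Finset (Lit V))
    (hne : ∀ i, (C i).Nonempty)
    (hnc : ∀ i, ∀ ℓ ∈ C i, ℓ.compl ∉ C i)
    (n k : ℕ) (hn : n = Fintype.card V) (hk : k = 2 * n + m + 1) :
    ((∃ θ : V → Bool, satCNF θ C) ↔
      {x : Arg V m | isFacet (stable Set.univ (attacksOf C)) x}.ncard = k) ∧
    ((¬ ∃ θ : V → Bool, satCNF θ C) ↔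
      {x : Arg V m | isFacet (stable Set.univ (attacksOf C)) x}.ncard = k - 1) := by
  have hfin : Finite (Arg V m) := Finite.of_equiv _ (argEquiv V m).symm
  have hcard : Nat.card (Arg V m) = k := by
    rw [Nat.card_congr (argEquiv V m), Nat.card_eq_fintype_card]
    simp only [Fintype.card_option, Fintype.card_sum, Fintype.card_fin]
    omega
  have hst := stable_extOf C
  have hlit : ∀ ℓ, isFacet (stable Set.univ (attacksOf C)) (.lit ℓ) := by
    intro ℓ
    obtain ⟨θ, h1⟩ := exists_eval ℓ
    obtain ⟨θ', h2⟩ := exists_eval ℓ.compl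
    refine ⟨⟨_, hst θ, h1⟩, fun h => ?_⟩
    have h3 : ℓ.eval θ' = true := h _ (hst θ')
    rw [eval_compl, h3] at h2
    cases h2
  have hcl : ∀ i, isFacet (stable Set.univ (attacksOf C)) (.clause i) := by
    intro i
    obtain ⟨θ, h1⟩ := exists_falsify (C i) (hnc i)
    obtain ⟨ℓ, hl⟩ := hne i
    obtain ⟨θ', h2⟩ := exists_eval ℓ
    refine ⟨⟨_, hst θ, h1⟩, fun h => ?_⟩
    have h3 : ¬ satClause θ' (C i) := h _ (hst θ')
    exact h3 ⟨ℓ, hl, h2⟩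
  have hfm : isFacet (stable Set.univ (attacksOf C)) .fm ↔ ∃ θ : V → Bool, satCNF θ C := by
    constructor
    · rintro ⟨⟨E, hE, hf⟩, _⟩
      exact sat_of_fm C E hE hf
    · rintro ⟨θ, hθ⟩
      obtain ⟨θ', h1⟩ := exists_falsify (C ⟨0, hm⟩) (hnc _)
      refine ⟨⟨_, hst θ, hθ⟩, fun h => ?_⟩
      have h3 : satCNF θ' C := h _ (hst θ')
      exact h1 (h3 _)
  by_cases hs : ∃ θ : V → Bool, satCNF θ C
  · have : {x : Arg V m | isFacet (stable Set.univ (attacksOf C)) x} = Set.univ := by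
      refine Set.eq_univ_of_forall fun x => ?_
      rcases x with _ | i | ℓ
      exacts [hfm.2 hs, hcl i, hlit ℓ]
    rw [this, Set.ncard_univ, hcard]
    simp only [hs, not_true, false_iff, true_and]
    omega
  · have : {x : Arg V m | isFacet (stable Set.univ (attacksOf C)) x} = {Arg.fm}ᶜ := by
      ext x
      rcases x with _ | i | ℓ
      · simp [hfm, hs]
      · simp [hcl]
      · simp [hlit]
    rw [this, Set.ncard_compl, Set.ncard_singleton, hcard]
    simp only [hs, not_false_eq_true, false_iff, and_true]
    omega
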